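/- arXiv:math/0306084 — 2 statements merged into one kernel-verified Lean document; each statement's English description precedes it below -/
import Mathlib

section
/- (Proposition 2, relation rt-6: exchange of the dressed transmission matrix with creation generators.) With t(k) = L(k)T(k)L(k)⁻¹, for all k₁,k₂ ∈ ℝ and all indices i,l,j ∈ {1,…,n}: t_{il}(k₁) a†_j(k₂) = Σ_{p,q,r,s} a†_p(k₂) [S₁₂(k₁,k₂)]^{(i,p)}_{(q,r)} t_{qs}(k₁) [S₂₁(k₂,k₁)]^{(s,r)}_{(l,j)}. -/
open scoped Matrix BigOperators

variable {n : ℕ}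

/-- `[S₂₁(k₂,k₁)]^{(i,j)}_{(p,q)} = [S(k₂,k₁)]^{(j,i)}_{(q,p)}`. -/
def S21 (S : ℝ → ℝ → Matrix (Fin n × Fin n) (Fin n × Fin n) ℂ) (k₂ k₁ : ℝ) :
    Matrix (Fin n × Fin n) (Fin n × Fin n) ℂ :=
  Matrix.of fun x y => S k₂ k₁ (x.2, x.1) (y.2, y.1)

/-- `M₁ = M ⊗ Iₙ`. -/
def leg1 {A : Type*} [Semiring A] [DecidableEq (Fin n)]
    (M : Matrix (Fin n) (Fin n) A) :
    Matrix (Fin n × Fin n) (Fin n × Fin n) A :=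
  Matrix.of fun x y => if x.2 = y.2 then M x.1 y.1 else 0

/-- `M₂ = Iₙ ⊗ M`. -/
def leg2 {A : Type*} [Semiring A] [DecidableEq (Fin n)]
    (M : Matrix (Fin n) (Fin n) A) :
    Matrix (Fin n × Fin n) (Fin n × Fin n) A :=
  Matrix.of fun x y => if x.1 = y.1 then M x.2 y.2 else 0

/-- entrywise embedding of a scalar `n² × n²` matrix into matrices over `𝒜`. -/
def emb (𝒜 : Type*) [Ring 𝒜] [Algebra ℂ 𝒜]
    (M : Matrix (Fin n × Fin n) (Fin n × Fin n) ℂ) :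
    Matrix (Fin n × Fin n) (Fin n × Fin n) 𝒜 :=
  M.map (algebraMap ℂ 𝒜)

/-- entrywise embedding of a scalar `n × n` matrix into matrices over `𝒜`. -/
def embn (𝒜 : Type*) [Ring 𝒜] [Algebra ℂ 𝒜] (M : Matrix (Fin n) (Fin n) ℂ) :
    Matrix (Fin n) (Fin n) 𝒜 :=
  M.map (algebraMap ℂ 𝒜)

/-- `W₁₂` acting on factors 1,2 of `(ℂⁿ)^{⊗3}`. -/
def leg12 (W : Matrix (Fin n × Fin n) (Fin n × Fin n) ℂ) :
    Matrix (Fin n × Fin n × Fin n) (Fin n × Fin n × Fin n) ℂ :=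
  Matrix.of fun x y => if x.2.2 = y.2.2 then W (x.1, x.2.1) (y.1, y.2.1) else 0

/-- `W₁₃` acting on factors 1,3 of `(ℂⁿ)^{⊗3}`. -/
def leg13 (W : Matrix (Fin n × Fin n) (Fin n × Fin n) ℂ) :
    Matrix (Fin n × Fin n × Fin n) (Fin n × Fin n × Fin n) ℂ :=
  Matrix.of fun x y => if x.2.1 = y.2.1 then W (x.1, x.2.2) (y.1, y.2.2) else 0

/-- `W₂₃` acting on factors 2,3 of `(ℂⁿ)^{⊗3}`. -/
def leg23 (W : Matrix (Fin n × Fin n) (Fin n × Fin n) ℂ) :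
    Matrix (Fin n × Fin n × Fin n) (Fin n × Fin n × Fin n) ℂ :=
  Matrix.of fun x y => if x.1 = y.1 then W (x.2.1, x.2.2) (y.2.1, y.2.2) else 0

/-- If the row index of `M` is exchanged with `b` through `W`, the same holds for `M * embn 𝒜 T`. -/
theorem exchange_mul_embn {𝒜 : Type*} [Ring 𝒜] [Algebra ℂ 𝒜]
    {W : Matrix (Fin n × Fin n) (Fin n × Fin n) ℂ} {b : Fin n → 𝒜}
    {M : Matrix (Fin n) (Fin n) 𝒜}
    (h : ∀ i l j, M i l * b j = ∑ p, ∑ q, W (i, p) (q, j) • (b p * M q l))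
    (T : Matrix (Fin n) (Fin n) ℂ) (i l j : Fin n) :
    (M * embn 𝒜 T) i l * b j = ∑ p, ∑ q, W (i, p) (q, j) • (b p * (M * embn 𝒜 T) q l) := by
  have entry (i l : Fin n) : (M * embn 𝒜 T) i l = ∑ m, T m l • M i m := by
    simp [Matrix.mul_apply, embn, Algebra.smul_def, Algebra.commutes]
  simp only [entry, Finset.sum_mul, Finset.mul_sum, Finset.smul_sum, smul_mul_assoc,
    mul_smul_comm, h]
  rw [Finset.sum_comm]
  refine Finset.sum_congr rfl fun p _ => ?_
  rw [Finset.sum_comm]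
  exact Finset.sum_congr rfl fun q _ => Finset.sum_congr rfl fun m _ => smul_comm _ _ _

/-- If the row index of `M` is exchanged with `b` through `W`, and `V` is a right inverse of `W`,
then the column index of `M⁻¹` is exchanged with `b` through `V`. -/
theorem inverse_exchange {𝒜 : Type*} [Ring 𝒜] [Algebra ℂ 𝒜]
    {W V : Matrix (Fin n × Fin n) (Fin n × Fin n) ℂ} (hWV : W * V = 1) {b : Fin n → 𝒜}
    {M N : Matrix (Fin n) (Fin n) 𝒜} (hMN : M * N = 1) (hNM : N * M = 1)
    (h : ∀ i l j, M i l * b j = ∑ p, ∑ q, W (i, p) (q, j) • (b p * M q l)) (u l j : Fin n) :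
    N u l * b j = ∑ r, ∑ s, V (s, r) (l, j) • (b r * N u s) := by
  have right_swap (i l j : Fin n) :
      ∑ m, M i m * b j * N m l = ∑ p, W (i, p) (l, j) • b p := by
    have entry (q : Fin n) : ∑ m, M q m * N m l = if q = l then 1 else 0 := by
      rw [← Matrix.mul_apply, hMN, Matrix.one_apply]
    simp only [h, Finset.sum_mul, smul_mul_assoc, mul_assoc]
    rw [Finset.sum_comm]
    refine Finset.sum_congr rfl fun p _ => ?_
    rw [Finset.sum_comm]
    simp only [← Finset.smul_sum, ← Finset.mul_sum, entry]
    simp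
  have swap (l j : Fin n) : b j * N u l = ∑ i, ∑ p, W (i, p) (l, j) • (N u i * b p) := by
    have entry (m : Fin n) : ∑ i, N u i * M i m = if u = m then 1 else 0 := by
      rw [← Matrix.mul_apply, hNM, Matrix.one_apply]
    calc b j * N u l = ∑ m, (∑ i, N u i * M i m) * (b j * N m l) := by simp [entry]
      _ = ∑ i, N u i * ∑ m, M i m * b j * N m l := by
        simp only [Finset.sum_mul, Finset.mul_sum, mul_assoc]
        exact Finset.sum_comm
      _ = _ := by simp only [right_swap, Finset.mul_sum, mul_smul_comm]
  symm
  calc ∑ r, ∑ s, V (s, r) (l, j) • (b r * N u s)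
      = ∑ y : Fin n × Fin n, V y (l, j) • (b y.2 * N u y.1) := by
        rw [Finset.sum_comm, Fintype.sum_prod_type]
    _ = ∑ y : Fin n × Fin n, ∑ x : Fin n × Fin n,
          (W x y * V y (l, j)) • (N u x.1 * b x.2) := by
        refine Finset.sum_congr rfl fun y _ => ?_
        rw [swap, ← Fintype.sum_prod_type', Finset.smul_sum]
        exact Finset.sum_congr rfl fun x _ => by rw [smul_smul, mul_comm]
    _ = ∑ x : Fin n × Fin n, (W * V) x (l, j) • (N u x.1 * b x.2) := by
        rw [Finset.sum_comm]
        simp only [Matrix.mul_apply, Finset.sum_smul]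
    _ = N u l * b j := by simp [hWV, Matrix.one_apply]

/-- Exchange of a product `M * N` with `b`, given exchange relations for the row index of `M`
and for the column index of `N`. -/
theorem mul_exchange {𝒜 : Type*} [Ring 𝒜] [Algebra ℂ 𝒜]
    {W V : Matrix (Fin n × Fin n) (Fin n × Fin n) ℂ} {b : Fin n → 𝒜}
    {M N : Matrix (Fin n) (Fin n) 𝒜}
    (hM : ∀ i l j, M i l * b j = ∑ p, ∑ q, W (i, p) (q, j) • (b p * M q l))
    (hN : ∀ u l j, N u l * b j = ∑ r, ∑ s, V (s, r) (l, j) • (b r * N u s)) (i l j : Fin n) :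
    (M * N) i l * b j =
      ∑ p, ∑ q, ∑ r, ∑ s, (W (i, p) (q, r) * V (s, r) (l, j)) • (b p * (M * N) q s) := by
  calc (M * N) i l * b j
      = ∑ r, ∑ s, ∑ u, V (s, r) (l, j) • (M i u * b r * N u s) := by
        simp only [Matrix.mul_apply, Finset.sum_mul, mul_assoc, hN, Finset.mul_sum,
          mul_smul_comm]
        rw [Finset.sum_comm]
        exact Finset.sum_congr rfl fun r _ => Finset.sum_comm
    _ = ∑ r, ∑ s, ∑ p, ∑ q, (W (i, p) (q, r) * V (s, r) (l, j)) • (b p * (M * N) q s) := by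
        refine Finset.sum_congr rfl fun r _ => Finset.sum_congr rfl fun s _ => ?_
        simp only [hM, Matrix.mul_apply, Finset.sum_mul, Finset.mul_sum, Finset.smul_sum,
          smul_mul_assoc, smul_smul, mul_assoc]
        rw [Finset.sum_comm]
        refine Finset.sum_congr rfl fun p _ => ?_
        rw [Finset.sum_comm]
        simp only [mul_comm]
    _ = _ := by
        rw [Finset.sum_congr rfl fun r _ => Finset.sum_comm, Finset.sum_comm]
        refine Finset.sum_congr rfl fun p _ => ?_
        rw [Finset.sum_congr rfl fun r _ => Finset.sum_comm, Finset.sum_comm]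

theorem stmt_2
    (hn : 1 ≤ n)
    (S : ℝ → ℝ → Matrix (Fin n × Fin n) (Fin n × Fin n) ℂ)
    (hU : ∀ k₁ k₂, S k₁ k₂ * S21 S k₂ k₁ = 1)
    (hYB : ∀ k₁ k₂ k₃,
      leg12 (S k₁ k₂) * leg13 (S k₁ k₃) * leg23 (S k₂ k₃) =
        leg23 (S k₂ k₃) * leg13 (S k₁ k₃) * leg12 (S k₁ k₂))
    (T R : ℝ → Matrix (Fin n) (Fin n) ℂ)
    (hT : ∀ k, (T k)ᴴ = T k)
    (hR : ∀ k, (R k)ᴴ = R (-k))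
    (hTRu : ∀ k, T k * T k + R k * R (-k) = 1)
    (hTRz : ∀ k, T k * R k + R k * T (-k) = 0)
    (hbYB : ∀ k₁ k₂,
      S k₁ k₂ * leg1 (R k₁) * S21 S k₂ (-k₁) * leg2 (R k₂) =
        leg2 (R k₂) * S k₁ (-k₂) * leg1 (R k₁) * S21 S (-k₂) (-k₁))
    (htYB : ∀ k₁ k₂,
      S k₁ k₂ * leg1 (T k₁) * S21 S k₂ k₁ * leg2 (T k₂) =
        leg2 (T k₂) * S k₁ k₂ * leg1 (T k₁) * S21 S k₂ k₁)
    (hrtYB : ∀ k₁ k₂,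
      S k₁ k₂ * leg1 (T k₁) * S21 S k₂ k₁ * leg2 (R k₂) =
        leg2 (R k₂) * S k₁ (-k₂) * leg1 (T k₁) * S21 S (-k₂) k₁)
    (𝒜 : Type*) [Ring 𝒜] [Algebra ℂ 𝒜]
    (a ad : ℝ → Fin n → 𝒜)
    (L Linv : ℝ → Matrix (Fin n) (Fin n) 𝒜)
    (hL : ∀ k, L k * Linv k = 1 ∧ Linv k * L k = 1)
    (hZF1 : ∀ k₁ k₂ (i j : Fin n), a k₁ i * a k₂ j =
      ∑ p, ∑ q, S21 S k₂ k₁ (i, j) (p, q) • (a k₂ q * a k₁ p))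
    (hZF2 : ∀ k₁ k₂ (i j : Fin n), ad k₁ i * ad k₂ j =
      ∑ p, ∑ q, S21 S k₂ k₁ (p, q) (i, j) • (ad k₂ q * ad k₁ p))
    (hWB1 : ∀ k₁ k₂ (i l j : Fin n), L k₁ i l * a k₂ j =
      ∑ p, ∑ q, S21 S k₂ k₁ (i, j) (p, q) • (a k₂ q * L k₁ p l))
    (hWB2 : ∀ k₁ k₂ (i l j : Fin n), L k₁ i l * ad k₂ j =
      ∑ p, ∑ q, S k₁ k₂ (i, p) (q, j) • (ad k₂ p * L k₁ q l))
    (hRLL : ∀ k₁ k₂,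
      emb 𝒜 (S k₁ k₂) * leg1 (L k₁) * leg2 (L k₂) =
        leg2 (L k₂) * leg1 (L k₁) * emb 𝒜 (S k₁ k₂))
    (t r : ℝ → Matrix (Fin n) (Fin n) 𝒜)
    (ht : ∀ k, t k = L k * embn 𝒜 (T k) * Linv k)
    (hr : ∀ k, r k = L k * embn 𝒜 (R k) * Linv (-k))
    :
    ∀ k₁ k₂ (i l j : Fin n),
      t k₁ i l * ad k₂ j =
      ∑ p, ∑ q, ∑ r', ∑ s,
        (S k₁ k₂ (i, p) (q, r') * S21 S k₂ k₁ (s, r') (l, j)) • (ad k₂ p * t k₁ q s) := by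
  intro k₁ k₂ i l j
  simp only [ht]
  exact mul_exchange (exchange_mul_embn (hWB2 k₁ k₂ · · ·) (T k₁))
    (inverse_exchange (hU k₁ k₂) (hL k₁).1 (hL k₁).2 (hWB2 k₁ k₂ · · ·)) i l j
end

section
/- (Proposition 2, relation rt-9: transmission–reflection exchange for the dressed matrices.) With t(k) = L(k)T(k)L(k)⁻¹ and r(k) = L(k)R(k)L(−k)⁻¹, for all k₁,k₂ ∈ ℝ the following identity holds in M_{n²}(𝒜): S₁₂(k₁,k₂) t₁(k₁) S₂₁(k₂,k₁) r₂(k₂) = r₂(k₂) S₁₂(k₁,−k₂) t₁(k₁) S₂₁(−k₂,k₁), where t₁ = t⊗Iₙ, r₂ = Iₙ⊗r and the scalar matrices S₁₂, S₂₁ act entrywise on 𝒜. -/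
open scoped Matrix BigOperators

variable {n : ℕ}

/-- The exchange relation `s T s⁻¹ R = R u T u⁻¹` passes to the elements `A T A⁻¹` and `B R C⁻¹`
dressed by solutions of the `RLL` relations `s A B = B A s` and `u A C = C A u`. -/
theorem dressed_exchange {M : Type*} [Monoid M] {s s' u u' T R A A' B C C' : M}
    (hs : s' * s = 1) (hss : s * s' = 1) (hu : u' * u = 1) (huu : u * u' = 1)
    (hA : A * A' = 1) (hA' : A' * A = 1) (hC : C * C' = 1) (hC' : C' * C = 1)
    (hB : s * A * B = B * A * s) (hBC : u * A * C = C * A * u)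
    (hTB : Commute T B) (hTC : Commute T C) (hRA : Commute R A)
    (h : s * T * s' * R = R * u * T * u') :
    s * (A * T * A') * s' * (B * R * C') = B * R * C' * u * (A * T * A') * u' := by
  let a : Mˣ := ⟨A, A', hA, hA'⟩
  let c : Mˣ := ⟨C, C', hC, hC'⟩
  let x : Mˣ := ⟨s, s', hss, hs⟩
  let y : Mˣ := ⟨u, u', huu, hu⟩
  have hRA' : Commute R A' := Commute.units_inv_right (u := a) hRA
  have hTC' : Commute T C' := Commute.units_inv_right (u := c) hTC
  have hleft : A' * s' * B = B * s' * A' := by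
    have : (↑(x * a)⁻¹ : M) * B = B * ↑(a * x)⁻¹ :=
      (Units.inv_mul_eq_iff_eq_mul _).2 <| by
        rw [← mul_assoc, Units.eq_mul_inv_iff_mul_eq]
        change B * (A * s) = s * A * B
        rw [hB, mul_assoc]
    rw [mul_inv_rev, mul_inv_rev] at this
    change A' * s' * B = B * (s' * A') at this
    rw [this, mul_assoc]
  have hright : C' * u * A = A * u * C' := by
    have : (↑c⁻¹ : M) * (u * A) = A * u * ↑c⁻¹ := by
      rw [Units.inv_mul_eq_iff_eq_mul, ← mul_assoc, Units.eq_mul_inv_iff_mul_eq]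
      change u * A * C = C * (A * u)
      rw [hBC, mul_assoc]
    rw [mul_assoc]
    exact this
  have hinv : u' * A' * C' = C' * A' * u' := by
    have : c * a * y = y * a * c := Units.ext hBC.symm
    have := congrArg (fun z : Mˣ => ((z⁻¹ : Mˣ) : M)) this
    simp only [mul_inv_rev, Units.val_mul, ← mul_assoc] at this
    exact this
  calc s * (A * T * A') * s' * (B * R * C')
      = s * A * T * (A' * s' * B) * R * C' := by simp only [mul_assoc]
    _ = s * A * (T * B) * s' * (A' * R) * C' := by rw [hleft]; simp only [mul_assoc]
    _ = (s * A * B) * T * s' * R * A' * C' := by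
        rw [hTB.eq, ← hRA'.eq]; simp only [mul_assoc]
    _ = B * A * (s * T * s' * R) * A' * C' := by rw [hB]; simp only [mul_assoc]
    _ = B * (A * R) * u * T * (u' * A' * C') := by rw [h]; simp only [mul_assoc]
    _ = B * R * A * u * (T * C') * A' * u' := by
        rw [hinv, ← hRA.eq]; simp only [mul_assoc]
    _ = B * R * (A * u * C') * T * A' * u' := by rw [hTC'.eq]; simp only [mul_assoc]
    _ = B * R * C' * u * (A * T * A') * u' := by rw [← hright]; simp only [mul_assoc]

theorem leg1_mul {A : Type*} [Semiring A] (M N : Matrix (Fin n) (Fin n) A) :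
    leg1 (M * N) = leg1 M * leg1 N := by
  ext ⟨i, j⟩ ⟨p, q⟩
  by_cases h : j = q <;> simp [leg1, Matrix.mul_apply, Fintype.sum_prod_type, h]

theorem leg2_mul {A : Type*} [Semiring A] (M N : Matrix (Fin n) (Fin n) A) :
    leg2 (M * N) = leg2 M * leg2 N := by
  ext ⟨i, j⟩ ⟨p, q⟩
  by_cases h : i = p <;> simp [leg2, Matrix.mul_apply, Fintype.sum_prod_type_right, h]

theorem leg1_one {A : Type*} [Semiring A] : leg1 (1 : Matrix (Fin n) (Fin n) A) = 1 := by
  ext ⟨i, j⟩ ⟨p, q⟩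
  by_cases h : j = q <;> simp [leg1, Matrix.one_apply, h]

theorem leg2_one {A : Type*} [Semiring A] : leg2 (1 : Matrix (Fin n) (Fin n) A) = 1 := by
  ext ⟨i, j⟩ ⟨p, q⟩
  by_cases h : i = p <;> simp [leg2, Matrix.one_apply, h]

theorem commute_leg1_leg2 {A : Type*} [Semiring A] {M N : Matrix (Fin n) (Fin n) A}
    (h : ∀ i j p q, Commute (M i j) (N p q)) : Commute (leg1 M) (leg2 N) := by
  ext ⟨i, j⟩ ⟨p, q⟩
  simp [leg1, leg2, Matrix.mul_apply, Fintype.sum_prod_type, (h i p j q).eq]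

section Embedding

variable (𝒜 : Type*) [Ring 𝒜] [Algebra ℂ 𝒜]

theorem emb_mul (M N : Matrix (Fin n × Fin n) (Fin n × Fin n) ℂ) :
    emb 𝒜 (M * N) = emb 𝒜 M * emb 𝒜 N :=
  Matrix.map_mul

theorem emb_one : emb 𝒜 (1 : Matrix (Fin n × Fin n) (Fin n × Fin n) ℂ) = 1 :=
  Matrix.map_one _ (map_zero _) (map_one _)

theorem emb_leg1 (M : Matrix (Fin n) (Fin n) ℂ) : emb 𝒜 (leg1 M) = leg1 (embn 𝒜 M) := by
  ext x y
  simp [emb, embn, leg1, apply_ite (algebraMap ℂ 𝒜)]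

theorem emb_leg2 (M : Matrix (Fin n) (Fin n) ℂ) : emb 𝒜 (leg2 M) = leg2 (embn 𝒜 M) := by
  ext x y
  simp [emb, embn, leg2, apply_ite (algebraMap ℂ 𝒜)]

end Embedding

theorem stmt_5
    (hn : 1 ≤ n)
    (S : ℝ → ℝ → Matrix (Fin n × Fin n) (Fin n × Fin n) ℂ)
    (hU : ∀ k₁ k₂, S k₁ k₂ * S21 S k₂ k₁ = 1)
    (hYB : ∀ k₁ k₂ k₃,
      leg12 (S k₁ k₂) * leg13 (S k₁ k₃) * leg23 (S k₂ k₃) =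
        leg23 (S k₂ k₃) * leg13 (S k₁ k₃) * leg12 (S k₁ k₂))
    (T R : ℝ → Matrix (Fin n) (Fin n) ℂ)
    (hT : ∀ k, (T k)ᴴ = T k)
    (hR : ∀ k, (R k)ᴴ = R (-k))
    (hTRu : ∀ k, T k * T k + R k * R (-k) = 1)
    (hTRz : ∀ k, T k * R k + R k * T (-k) = 0)
    (hbYB : ∀ k₁ k₂,
      S k₁ k₂ * leg1 (R k₁) * S21 S k₂ (-k₁) * leg2 (R k₂) =
        leg2 (R k₂) * S k₁ (-k₂) * leg1 (R k₁) * S21 S (-k₂) (-k₁))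
    (htYB : ∀ k₁ k₂,
      S k₁ k₂ * leg1 (T k₁) * S21 S k₂ k₁ * leg2 (T k₂) =
        leg2 (T k₂) * S k₁ k₂ * leg1 (T k₁) * S21 S k₂ k₁)
    (hrtYB : ∀ k₁ k₂,
      S k₁ k₂ * leg1 (T k₁) * S21 S k₂ k₁ * leg2 (R k₂) =
        leg2 (R k₂) * S k₁ (-k₂) * leg1 (T k₁) * S21 S (-k₂) k₁)
    (𝒜 : Type*) [Ring 𝒜] [Algebra ℂ 𝒜]
    (a ad : ℝ → Fin n → 𝒜)
    (L Linv : ℝ → Matrix (Fin n) (Fin n) 𝒜)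
    (hL : ∀ k, L k * Linv k = 1 ∧ Linv k * L k = 1)
    (hZF1 : ∀ k₁ k₂ (i j : Fin n), a k₁ i * a k₂ j =
      ∑ p, ∑ q, S21 S k₂ k₁ (i, j) (p, q) • (a k₂ q * a k₁ p))
    (hZF2 : ∀ k₁ k₂ (i j : Fin n), ad k₁ i * ad k₂ j =
      ∑ p, ∑ q, S21 S k₂ k₁ (p, q) (i, j) • (ad k₂ q * ad k₁ p))
    (hWB1 : ∀ k₁ k₂ (i l j : Fin n), L k₁ i l * a k₂ j =
      ∑ p, ∑ q, S21 S k₂ k₁ (i, j) (p, q) • (a k₂ q * L k₁ p l))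
    (hWB2 : ∀ k₁ k₂ (i l j : Fin n), L k₁ i l * ad k₂ j =
      ∑ p, ∑ q, S k₁ k₂ (i, p) (q, j) • (ad k₂ p * L k₁ q l))
    (hRLL : ∀ k₁ k₂,
      emb 𝒜 (S k₁ k₂) * leg1 (L k₁) * leg2 (L k₂) =
        leg2 (L k₂) * leg1 (L k₁) * emb 𝒜 (S k₁ k₂))
    (t r : ℝ → Matrix (Fin n) (Fin n) 𝒜)
    (ht : ∀ k, t k = L k * embn 𝒜 (T k) * Linv k)
    (hr : ∀ k, r k = L k * embn 𝒜 (R k) * Linv (-k))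
    :
    ∀ k₁ k₂,
      emb 𝒜 (S k₁ k₂) * leg1 (t k₁) * emb 𝒜 (S21 S k₂ k₁) * leg2 (r k₂) =
        leg2 (r k₂) * emb 𝒜 (S k₁ (-k₂)) * leg1 (t k₁) * emb 𝒜 (S21 S (-k₂) k₁) := by
  intro k₁ k₂
  have hinv : ∀ l₁ l₂, emb 𝒜 (S l₁ l₂) * emb 𝒜 (S21 S l₂ l₁) = 1 := fun l₁ l₂ => by
    rw [← emb_mul, hU, emb_one]
  have hinv' : ∀ l₁ l₂, emb 𝒜 (S21 S l₂ l₁) * emb 𝒜 (S l₁ l₂) = 1 := fun l₁ l₂ => by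
    rw [← emb_mul, mul_eq_one_comm.1 (hU l₁ l₂), emb_one]
  have hundressed := congrArg (emb 𝒜) (hrtYB k₁ k₂)
  simp only [emb_mul, emb_leg1, emb_leg2] at hundressed
  rw [ht, hr]
  simp only [leg1_mul, leg2_mul]
  refine dressed_exchange (hinv' _ _) (hinv _ _) (hinv' _ _) (hinv _ _) ?_ ?_ ?_ ?_
    (hRLL k₁ k₂) (hRLL k₁ (-k₂)) ?_ ?_ ?_ hundressed
  · rw [← leg1_mul, (hL k₁).1, leg1_one]
  · rw [← leg1_mul, (hL k₁).2, leg1_one]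
  · rw [← leg2_mul, (hL (-k₂)).1, leg2_one]
  · rw [← leg2_mul, (hL (-k₂)).2, leg2_one]
  · exact commute_leg1_leg2 fun _ _ _ _ => Algebra.commutes _ _
  · exact commute_leg1_leg2 fun _ _ _ _ => Algebra.commutes _ _
  · exact (commute_leg1_leg2 fun _ _ _ _ => (Algebra.commutes _ _).symm).symm
end
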